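/- Let M̄ be an admissible completion as a point set of (M,≪), endowed with a topology τ which satisfies the admissibility condition (A1). Then τ satisfies (A2) if and only if it satisfies both of the following: (A2)' whenever a sequence ((P_n,F_n)) in M̄ τ-converges to (P,∅) and P ⊆ P' ⊆ LI(P_n) for some (P',F') ∈ M̄, then the constant sequence ((P',F'))_n also τ-converges to (P,∅), and dually for limits (∅,F); (A2)'' τ is T1. -/

import Mathlib

open Filter Set Topology

variable {M : Type*}

/-- The chronological past `I⁻(p)` of a point. -/
def IPast (r : M → M → Prop) (p : M) : Set M := {q | r q p}

/-- The chronological future `I⁺(p)` of a point. -/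
def IFut (r : M → M → Prop) (p : M) : Set M := {q | r p q}

/-- The chronological past `I⁻[S]` of a set. -/
def IPastS (r : M → M → Prop) (S : Set M) : Set M := ⋃ s ∈ S, IPast r s

/-- The chronological future `I⁺[S]` of a set. -/
def IFutS (r : M → M → Prop) (S : Set M) : Set M := ⋃ s ∈ S, IFut r s

/-- A past set: `P = I⁻[P]`. -/
def IsPastSet (r : M → M → Prop) (P : Set M) : Prop := P = IPastS r P

/-- A future set: `F = I⁺[F]`. -/
def IsFutSet (r : M → M → Prop) (F : Set M) : Prop := F = IFutS r F

/-- An indecomposable past set (IP). -/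
def IsIP (r : M → M → Prop) (P : Set M) : Prop :=
  P.Nonempty ∧ IsPastSet r P ∧
    ¬∃ P₁ P₂ : Set M, IsPastSet r P₁ ∧ IsPastSet r P₂ ∧ P₁ ⊂ P ∧ P₂ ⊂ P ∧ P = P₁ ∪ P₂

/-- An indecomposable future set (IF). -/
def IsIF (r : M → M → Prop) (F : Set M) : Prop :=
  F.Nonempty ∧ IsFutSet r F ∧
    ¬∃ F₁ F₂ : Set M, IsFutSet r F₁ ∧ IsFutSet r F₂ ∧ F₁ ⊂ F ∧ F₂ ⊂ F ∧ F = F₁ ∪ F₂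

/-- A terminal IP (TIP): an IP which is not of the form `I⁻(p)`. -/
def IsTIP (r : M → M → Prop) (P : Set M) : Prop := IsIP r P ∧ ∀ p : M, P ≠ IPast r p

/-- A terminal IF (TIF). -/
def IsTIF (r : M → M → Prop) (F : Set M) : Prop := IsIF r F ∧ ∀ p : M, F ≠ IFut r p

/-- The common future `↑P`. -/
def commonFut (r : M → M → Prop) (P : Set M) : Set M := IFutS r {q | ∀ p ∈ P, r p q}

/-- The common past `↓F`. -/
def commonPast (r : M → M → Prop) (F : Set M) : Set M := IPastS r {q | ∀ p ∈ F, r q p}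

/-- `P` is a maximal IP contained in `S`. -/
def MaxIPIn (r : M → M → Prop) (P S : Set M) : Prop :=
  IsIP r P ∧ P ⊆ S ∧ ∀ P', IsIP r P' → P' ⊆ S → P ⊆ P' → P = P'

/-- `F` is a maximal IF contained in `S`. -/
def MaxIFIn (r : M → M → Prop) (F S : Set M) : Prop :=
  IsIF r F ∧ F ⊆ S ∧ ∀ F', IsIF r F' → F' ⊆ S → F ⊆ F' → F = F'

/-- The Szabados relation between (nonempty) indecomposable sets: `F` is a maximal IF
contained in `↑P` and `P` is a maximal IP contained in `↓F`. -/
def SRelNE (r : M → M → Prop) (P F : Set M) : Prop :=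
  MaxIFIn r F (commonFut r P) ∧ MaxIPIn r P (commonPast r F)

/-- The full S-relation, allowing one empty component. -/
def SRel (r : M → M → Prop) (P F : Set M) : Prop :=
  SRelNE r P F ∨
    (F = ∅ ∧ IsIP r P ∧ ∀ F', IsIF r F' → ¬SRelNE r P F') ∨
    (P = ∅ ∧ IsIF r F ∧ ∀ P', IsIP r P' → ¬SRelNE r P' F)

/-- The embedding `i(p) = (I⁻(p), I⁺(p))`. -/
def chrEmb (r : M → M → Prop) (p : M) : Set M × Set M := (IPast r p, IFut r p)

/-- The image `i(M)` inside the set of pairs. -/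
def imgM (r : M → M → Prop) : Set (Set M × Set M) := Set.range (chrEmb r)

/-- An admissible completion as a point set. -/
structure IsAdmissibleCompletion (r : M → M → Prop) (Mb : Set (Set M × Set M)) : Prop where
  mem_point : ∀ p : M, chrEmb r p ∈ Mb
  complete_TIP : ∀ P : Set M, IsTIP r P → ∃ x ∈ Mb \ imgM r, x.1 = P
  complete_TIF : ∀ F : Set M, IsTIF r F → ∃ x ∈ Mb \ imgM r, x.2 = F
  srel : ∀ x ∈ Mb, SRel r x.1 x.2

/-- The extended chronological relation `(P,F) ≪̄ (P',F') ↔ F ∩ P' ≠ ∅`. -/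
def extChron (x y : Set M × Set M) : Prop := (x.2 ∩ y.1).Nonempty

/-- A chronology: a transitive and anti-reflexive binary relation. -/
def IsChronology (r : M → M → Prop) : Prop := Transitive r ∧ Irreflexive r

/-- A chronological set: a chronology with no isolates which is chronologically separable. -/
def IsChronologicalSet (r : M → M → Prop) : Prop :=
  IsChronology r ∧ (∀ x, ∃ y, r x y ∨ r y x) ∧
    ∃ S : Set M, S.Countable ∧ ∀ x y, r x y → ∃ s ∈ S, r x s ∧ r s y
/-- The chronological future of a point of the completion, inside the completion,
with respect to the extended chronological relation. -/
def futIn (Mb : Set (Set M × Set M)) (x : ↥Mb) : Set ↥Mb :=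
  {y | extChron (x : Set M × Set M) (y : Set M × Set M)}

/-- The chronological past of a point of the completion, inside the completion. -/
def pastIn (Mb : Set (Set M × Set M)) (x : ↥Mb) : Set ↥Mb :=
  {y | extChron (y : Set M × Set M) (x : Set M × Set M)}

/-- CEAT: the coarsest topology on the completion in which all the sets `I⁺((P,F))`
and `I⁻((P,F))` are open. -/
def CEAT (Mb : Set (Set M × Set M)) : TopologicalSpace ↥Mb :=
  TopologicalSpace.generateFrom
    ({S | ∃ x : ↥Mb, S = futIn Mb x} ∪ {S | ∃ x : ↥Mb, S = pastIn Mb x})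

/-- The set-theoretic inferior limit of a sequence of sets. -/
def setLI (A : ℕ → Set M) : Set M := {x | ∀ᶠ n in Filter.atTop, x ∈ A n}

/-- The set-theoretic superior limit of a sequence of sets. -/
def setLS (A : ℕ → Set M) : Set M := {x | ∃ᶠ n in Filter.atTop, x ∈ A n}

/-- The chronological limit operator (on pairs). -/
def chrLim (r : M → M → Prop) (σ : ℕ → Set M × Set M) (x : Set M × Set M) : Prop :=
  (x.1 ≠ ∅ → x.1 ⊆ setLI (fun n => (σ n).1) ∧ MaxIPIn r x.1 (setLS fun n => (σ n).1)) ∧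
  (x.2 ≠ ∅ → x.2 ⊆ setLI (fun n => (σ n).2) ∧ MaxIFIn r x.2 (setLS fun n => (σ n).2))

/-- The topology derived from a limit operator: closed sets are those containing all the
`L`-limits of their sequences. -/
def derivedTop {X : Type*} (L : (ℕ → X) → Set X)
    (hL : ∀ (σ : ℕ → X) (φ : ℕ → ℕ), StrictMono φ → L σ ⊆ L (σ ∘ φ)) :
    TopologicalSpace X where
  IsOpen U := ∀ σ : ℕ → X, (∀ n, σ n ∈ Uᶜ) → L σ ⊆ Uᶜ
  isOpen_univ := by
    intro σ h
    simpa using h 0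
  isOpen_inter := by
    intro U V hU hV σ hσ x hx
    have h : ∀ n, σ n ∈ Uᶜ ∨ σ n ∈ Vᶜ := by
      intro n
      have h' := hσ n
      rw [Set.compl_inter] at h'
      exact h'
    have hfreq : (∃ᶠ n in Filter.atTop, σ n ∈ Uᶜ) ∨ ∃ᶠ n in Filter.atTop, σ n ∈ Vᶜ :=
      Filter.frequently_or_distrib.mp (Filter.Frequently.of_forall h)
    rw [Set.compl_inter]
    rcases hfreq with hf | hf
    · obtain ⟨φ, hφ, hmem⟩ := Filter.extraction_of_frequently_atTop hf
      exact Or.inl (hU (σ ∘ φ) hmem (hL σ φ hφ hx))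
    · obtain ⟨φ, hφ, hmem⟩ := Filter.extraction_of_frequently_atTop hf
      exact Or.inr (hV (σ ∘ φ) hmem (hL σ φ hφ hx))
  isOpen_sUnion := by
    intro S hS σ hσ x hx
    intro hmem
    rcases hmem with ⟨U, hU, hxU⟩
    exact hS U hU σ (fun n h => hσ n ⟨U, hU, h⟩) hx hxU

lemma setLI_subseq {A : ℕ → Set M} {φ : ℕ → ℕ} (hφ : StrictMono φ) :
    setLI A ⊆ setLI fun n => A (φ n) :=
  fun _ hx => hφ.tendsto_atTop.eventually hx

lemma setLS_subseq {A : ℕ → Set M} {φ : ℕ → ℕ} (hφ : StrictMono φ) :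
    (setLS fun n => A (φ n)) ⊆ setLS A :=
  fun _ hx => hφ.tendsto_atTop.frequently hx

/-- The chronological limit operator on the completion. -/
def chrL (r : M → M → Prop) (Mb : Set (Set M × Set M)) (σ : ℕ → ↥Mb) : Set ↥Mb :=
  {x | chrLim r (fun n => ((σ n : Set M × Set M))) (x : Set M × Set M)}

lemma chrL_subseq (r : M → M → Prop) (Mb : Set (Set M × Set M)) :
    ∀ (σ : ℕ → ↥Mb) (φ : ℕ → ℕ), StrictMono φ → chrL r Mb σ ⊆ chrL r Mb (σ ∘ φ) := by
  intro σ φ hφ x hx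
  obtain ⟨h1, h2⟩ := hx
  constructor
  · intro hne
    obtain ⟨hli, hmax⟩ := h1 hne
    exact ⟨fun y hy => setLI_subseq hφ (hli hy), hmax.1,
      fun y hy => Filter.Eventually.frequently (setLI_subseq hφ (hli hy)),
      fun P' hP' hP'sub hsub => hmax.2.2 P' hP' (fun y hy => setLS_subseq hφ (hP'sub hy)) hsub⟩
  · intro hne
    obtain ⟨hli, hmax⟩ := h2 hne
    exact ⟨fun y hy => setLI_subseq hφ (hli hy), hmax.1,
      fun y hy => Filter.Eventually.frequently (setLI_subseq hφ (hli hy)),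
      fun F' hF' hF'sub hsub => hmax.2.2 F' hF' (fun y hy => setLS_subseq hφ (hF'sub hy)) hsub⟩

/-- The chronological topology on the completion. -/
def chrTop (r : M → M → Prop) (Mb : Set (Set M × Set M)) : TopologicalSpace ↥Mb :=
  derivedTop (chrL r Mb) (chrL_subseq r Mb)

/-- Admissibility condition (A1): chronological futures and pasts are open. -/
def CondA1 (Mb : Set (Set M × Set M)) (τ : TopologicalSpace ↥Mb) : Prop :=
  ∀ x : ↥Mb, IsOpen[τ] (futIn Mb x) ∧ IsOpen[τ] (pastIn Mb x)

/-- Admissibility condition (A2). -/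
def CondA2 (Mb : Set (Set M × Set M)) (τ : TopologicalSpace ↥Mb) : Prop :=
  (∀ (σ : ℕ → ↥Mb) (x : ↥Mb), Filter.Tendsto σ Filter.atTop (@nhds _ τ x) →
      (x : Set M × Set M).2 = ∅ →
      ∀ y : ↥Mb, (x : Set M × Set M).1 ⊆ (y : Set M × Set M).1 →
        (y : Set M × Set M).1 ⊆ setLI (fun n => ((σ n : Set M × Set M)).1) → y = x) ∧
  (∀ (σ : ℕ → ↥Mb) (x : ↥Mb), Filter.Tendsto σ Filter.atTop (@nhds _ τ x) →
      (x : Set M × Set M).1 = ∅ →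
      ∀ y : ↥Mb, (x : Set M × Set M).2 ⊆ (y : Set M × Set M).2 →
        (y : Set M × Set M).2 ⊆ setLI (fun n => ((σ n : Set M × Set M)).2) → y = x)

/-- Admissibility condition (A3): maximal coarseness among (A1)∧(A2) topologies. -/
def CondA3 (Mb : Set (Set M × Set M)) (τ : TopologicalSpace ↥Mb) : Prop :=
  ∀ τ' : TopologicalSpace ↥Mb, CondA1 Mb τ' → CondA2 Mb τ' → ¬(τ < τ')

/-- Condition (A2)': the weakened form of (A2), where the conclusion is that the constant
sequence with value `(P',F')` also converges to the limit pair. -/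
def CondA2' (Mb : Set (Set M × Set M)) (τ : TopologicalSpace ↥Mb) : Prop :=
  (∀ (σ : ℕ → ↥Mb) (x : ↥Mb), Filter.Tendsto σ Filter.atTop (@nhds _ τ x) →
      (x : Set M × Set M).2 = ∅ →
      ∀ y : ↥Mb, (x : Set M × Set M).1 ⊆ (y : Set M × Set M).1 →
        (y : Set M × Set M).1 ⊆ setLI (fun n => ((σ n : Set M × Set M)).1) →
        Filter.Tendsto (fun _ : ℕ => y) Filter.atTop (@nhds _ τ x)) ∧
  (∀ (σ : ℕ → ↥Mb) (x : ↥Mb), Filter.Tendsto σ Filter.atTop (@nhds _ τ x) →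
      (x : Set M × Set M).1 = ∅ →
      ∀ y : ↥Mb, (x : Set M × Set M).2 ⊆ (y : Set M × Set M).2 →
        (y : Set M × Set M).2 ⊆ setLI (fun n => ((σ n : Set M × Set M)).2) →
        Filter.Tendsto (fun _ : ℕ => y) Filter.atTop (@nhds _ τ x))

lemma mem_of_mem_of_isPastSet {r : M → M → Prop} {P : Set M} (hP : IsPastSet r P) {p q : M}
    (hq : q ∈ P) (hpq : r p q) : p ∈ P := by
  rw [hP]
  exact mem_biUnion hq hpq

lemma exists_rel_of_isPastSet {r : M → M → Prop} {P : Set M} (hP : IsPastSet r P) {p : M}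
    (hp : p ∈ P) : ∃ q ∈ P, r p q := by
  rw [hP] at hp
  obtain ⟨q, hq, hpq⟩ := mem_iUnion₂.mp hp
  exact ⟨q, hq, hpq⟩

lemma mem_of_mem_of_isFutSet {r : M → M → Prop} {F : Set M} (hF : IsFutSet r F) {p q : M}
    (hp : p ∈ F) (hpq : r p q) : q ∈ F := by
  rw [hF]
  exact mem_biUnion hp hpq

lemma exists_rel_of_isFutSet {r : M → M → Prop} {F : Set M} (hF : IsFutSet r F) {q : M}
    (hq : q ∈ F) : ∃ p ∈ F, r p q := by
  rw [hF] at hq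
  obtain ⟨p, hp, hpq⟩ := mem_iUnion₂.mp hq
  exact ⟨p, hp, hpq⟩

lemma SRel.isPastSet {r : M → M → Prop} {P F : Set M} (h : SRel r P F) : IsPastSet r P := by
  rcases h with h | ⟨-, h, -⟩ | ⟨rfl, -, -⟩
  · exact h.2.1.2.1
  · exact h.2.1
  · simp [IsPastSet, IPastS]

lemma SRel.isFutSet {r : M → M → Prop} {P F : Set M} (h : SRel r P F) : IsFutSet r F := by
  rcases h with h | ⟨rfl, -, -⟩ | ⟨-, h, -⟩
  · exact h.1.1.2.1
  · simp [IsFutSet, IFutS]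
  · exact h.2.1

lemma SRel.sRelNE {r : M → M → Prop} {P F : Set M} (h : SRel r P F) (hP : P ≠ ∅) (hF : F ≠ ∅) :
    SRelNE r P F := by
  rcases h with h | ⟨h, -⟩ | ⟨h, -⟩
  · exact h
  · exact absurd h hF
  · exact absurd h hP

lemma commonFut_anti (r : M → M → Prop) {P P' : Set M} (h : P ⊆ P') :
    commonFut r P' ⊆ commonFut r P :=
  biUnion_subset_biUnion_left fun _ hq p hp => hq p (h hp)

lemma commonPast_anti (r : M → M → Prop) {F F' : Set M} (h : F ⊆ F') :
    commonPast r F' ⊆ commonPast r F :=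
  biUnion_subset_biUnion_left fun _ hq p hp => hq p (h hp)

/-- S-related pairs of nonempty sets are maximal for componentwise inclusion. -/
lemma SRelNE.eq_of_subset {r : M → M → Prop} {P F P' F' : Set M} (h : SRelNE r P F)
    (h' : SRelNE r P' F') (hP : P ⊆ P') (hF : F ⊆ F') : P = P' ∧ F = F' :=
  ⟨h.2.2.2 P' h'.2.1 (h'.2.2.1.trans (commonPast_anti r hF)) hP,
    h.1.2.2 F' h'.1.1 (h'.1.2.1.trans (commonFut_anti r hP)) hF⟩

/-- Under (A1), specialization is contained in componentwise inclusion. -/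
lemma subset_and_subset_of_specializes {r : M → M → Prop} {Mb : Set (Set M × Set M)}
    (hMb : IsAdmissibleCompletion r Mb) [τ : TopologicalSpace ↥Mb] (hA1 : CondA1 Mb τ)
    {y x : ↥Mb} (h : y ⤳ x) : x.1.1 ⊆ y.1.1 ∧ x.1.2 ⊆ y.1.2 := by
  have hx := hMb.srel x.1 x.2
  have hy := hMb.srel y.1 y.2
  constructor
  · intro p hp
    obtain ⟨q, hq, hpq⟩ := exists_rel_of_isPastSet hx.isPastSet hp
    obtain ⟨s, hs, hs'⟩ : y ∈ futIn Mb ⟨chrEmb r p, hMb.mem_point p⟩ :=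
      h.mem_open (hA1 _).1 ⟨q, hpq, hq⟩
    exact mem_of_mem_of_isPastSet hy.isPastSet hs' hs
  · intro p hp
    obtain ⟨q, hq, hqp⟩ := exists_rel_of_isFutSet hx.isFutSet hp
    obtain ⟨s, hs, hs'⟩ : y ∈ pastIn Mb ⟨chrEmb r p, hMb.mem_point p⟩ :=
      h.mem_open (hA1 _).2 ⟨q, hq, hqp⟩
    exact mem_of_mem_of_isFutSet hy.isFutSet hs hs'

lemma CondA2.t1Space {r : M → M → Prop} {Mb : Set (Set M × Set M)}
    (hMb : IsAdmissibleCompletion r Mb) [τ : TopologicalSpace ↥Mb] (hA1 : CondA1 Mb τ)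
    (hA2 : CondA2 Mb τ) : T1Space ↥Mb := by
  rw [t1Space_iff_specializes_imp_eq]
  intro y x h
  obtain ⟨hP, hF⟩ := subset_and_subset_of_specializes hMb hA1 h
  have hconst : Tendsto (fun _ : ℕ => y) atTop (𝓝 x) := tendsto_const_nhds.mono_right h
  by_cases hx2 : x.1.2 = ∅
  · exact hA2.1 _ x hconst hx2 y hP fun _ hp => Eventually.of_forall fun _ => hp
  by_cases hx1 : x.1.1 = ∅
  · exact hA2.2 _ x hconst hx1 y hF fun _ hp => Eventually.of_forall fun _ => hp
  have hxS := (hMb.srel x.1 x.2).sRelNE hx1 hx2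
  have hyS := (hMb.srel y.1 y.2).sRelNE (fun h0 => hx1 (subset_eq_empty hP h0))
    (fun h0 => hx2 (subset_eq_empty hF h0))
  obtain ⟨h1, h2⟩ := hxS.eq_of_subset hyS hP hF
  exact Subtype.ext (Prod.ext h1.symm h2.symm)

/-- **Proposition.** Given a topology `τ` on an admissible completion as a point set which
satisfies (A1), condition (A2) is equivalent to the conjunction of (A2)' and (A2)''
(`τ` is T1). -/
theorem condA2_iff_condA2'_and_t1
    (r : M → M → Prop) (hr : IsChronology r)
    (Mb : Set (Set M × Set M)) (hMb : IsAdmissibleCompletion r Mb)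
    (τ : TopologicalSpace ↥Mb) (hA1 : CondA1 Mb τ) :
    CondA2 Mb τ ↔ (CondA2' Mb τ ∧ @T1Space ↥Mb τ) := by
  constructor
  · intro h
    refine ⟨⟨fun σ x hσ hx y hxy hy => ?_, fun σ x hσ hx y hxy hy => ?_⟩,
      CondA2.t1Space hMb hA1 h⟩
    · rw [h.1 σ x hσ hx y hxy hy]
      exact tendsto_const_nhds
    · rw [h.2 σ x hσ hx y hxy hy]
      exact tendsto_const_nhds
  · rintro ⟨h, _⟩
    exact ⟨fun σ x hσ hx y hxy hy => tendsto_const_nhds_iff.mp (h.1 σ x hσ hx y hxy hy),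
      fun σ x hσ hx y hxy hy => tendsto_const_nhds_iff.mp (h.2 σ x hσ hx y hxy hy)⟩
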